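/- arXiv:1305.4040 — 6 statements merged into one kernel-verified Lean document; each statement's English description precedes it below -/
import Mathlib

section
/- Sober spaces are reflective in Top: for every topological space X, the space pt X is sober, the map η_X : X → pt X is continuous, and for every continuous map f : X → Y into a sober space Y there exists a unique continuous map f* : pt X → Y with f* ∘ η_X = f. -/
open TopologicalSpace Topology

/-- `pt X`: the "points" of the frame `Opens X`, i.e. frame homomorphisms `Opens X → Prop`. -/
abbrev PtSpace (X : Type*) [TopologicalSpace X] : Type _ := FrameHom (Opens X) Prop

variable {X : Type*} [TopologicalSpace X]

/-- The map `Opens X → Prop`, `U ↦ (x ∈ U)`, as a frame homomorphism. -/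
def etaHom (x : X) : PtSpace X where
  toFun U := x ∈ U
  map_inf' U V := by
    simp only [eq_iff_iff, inf_Prop_eq]
    exact Iff.rfl
  map_top' := by
    simp only [eq_iff_iff]
    exact iff_of_true (Opens.mem_top x) trivial
  map_sSup' S := by
    simp only [eq_iff_iff, Opens.mem_sSup, sSup_Prop_eq]
    constructor
    · rintro ⟨U, hU, hx⟩; exact ⟨(x ∈ U), ⟨U, hU, rfl⟩, hx⟩
    · rintro ⟨p, ⟨U, hU, rfl⟩, hx⟩; exact ⟨U, hU, hx⟩

/-- The topology on `pt X` whose open sets are exactly those of the form `{φ | φ U}`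
for `U : Opens X`. -/
instance ptTop : TopologicalSpace (PtSpace X) where
  IsOpen s := ∃ U : Opens X, s = {φ : PtSpace X | φ U}
  isOpen_univ := ⟨⊤, by ext φ; simp⟩
  isOpen_inter := by
    rintro s t ⟨U, rfl⟩ ⟨V, rfl⟩
    refine ⟨U ⊓ V, ?_⟩
    ext φ
    simp only [Set.mem_inter_iff, Set.mem_setOf_eq, map_inf, inf_Prop_eq]
  isOpen_sUnion := by
    intro S hS
    refine ⟨sSup {U : Opens X | {φ : PtSpace X | φ U} ∈ S}, ?_⟩
    ext φ
    simp only [Set.mem_sUnion, Set.mem_setOf_eq, map_sSup, sSup_Prop_eq]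
    constructor
    · rintro ⟨s, hs, hφ⟩
      obtain ⟨U, rfl⟩ := hS s hs
      exact ⟨φ U, ⟨U, hs, rfl⟩, hφ⟩
    · rintro ⟨p, ⟨U, hU, rfl⟩, hφ⟩
      exact ⟨_, hU, hφ⟩

/-- The unit map `η_X : X → pt X`, `η_X(x)(U) = (x ∈ U)`. -/
def eta (X : Type*) [TopologicalSpace X] : X → PtSpace X := fun x => etaHom x

theorem PtSpace.isOpen_setOf (U : Opens X) : IsOpen {φ : PtSpace X | φ U} :=
  ⟨U, rfl⟩

theorem PtSpace.t0Space : T0Space (PtSpace X) where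
  t0 _ _ h := DFunLike.ext _ _ fun U =>
    propext (h.mem_open_iff (PtSpace.isOpen_setOf U))

theorem eta_continuous : Continuous (eta X) := by
  refine continuous_def.2 ?_
  rintro _ ⟨U, rfl⟩
  exact U.isOpen

/-- The point of `pt X` attached to an irreducible set `S` of `pt X`: it holds on `U` when
the basic open set of `U` meets `S`. -/
def PtSpace.ofIrreducible {S : Set (PtSpace X)} (hS : IsIrreducible S) : PtSpace X where
  toFun U := (S ∩ {φ : PtSpace X | φ U}).Nonempty
  map_inf' U V := by
    refine propext ⟨?_, ?_⟩
    · rintro ⟨φ, hφ, h⟩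
      rw [Set.mem_ofPred_eq, map_inf] at h
      exact ⟨⟨φ, hφ, h.1⟩, ⟨φ, hφ, h.2⟩⟩
    · rintro ⟨hU, hV⟩
      obtain ⟨φ, hφ, h⟩ := hS.2 _ _ (PtSpace.isOpen_setOf U) (PtSpace.isOpen_setOf V) hU hV
      refine ⟨φ, hφ, ?_⟩
      rw [Set.mem_ofPred_eq, map_inf]
      exact h
  map_top' := by
    obtain ⟨φ, hφ⟩ := hS.1
    refine propext ⟨fun _ => trivial, fun _ => ⟨φ, hφ, ?_⟩⟩
    rw [Set.mem_ofPred_eq, map_top]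
    trivial
  map_sSup' T := by
    refine propext ⟨?_, ?_⟩
    · rintro ⟨φ, hφ, h⟩
      rw [Set.mem_ofPred_eq, map_sSup, sSup_Prop_eq] at h
      obtain ⟨_, ⟨U, hU, rfl⟩, h⟩ := h
      rw [sSup_Prop_eq]
      exact ⟨_, ⟨U, hU, rfl⟩, φ, hφ, h⟩
    · intro h
      rw [sSup_Prop_eq] at h
      obtain ⟨_, ⟨U, hU, rfl⟩, φ, hφ, h⟩ := h
      refine ⟨φ, hφ, ?_⟩
      rw [Set.mem_ofPred_eq, map_sSup, sSup_Prop_eq]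
      exact ⟨_, ⟨U, hU, rfl⟩, h⟩

theorem PtSpace.quasiSober : QuasiSober (PtSpace X) where
  sober {S} hS hc := by
    refine ⟨PtSpace.ofIrreducible hS, isGenericPoint_iff_specializes.2 fun ψ => ?_⟩
    rw [specializes_iff_forall_open]
    constructor
    · intro h
      by_contra hψ
      obtain ⟨U, hU⟩ := hc.isOpen_compl
      have hmem : PtSpace.ofIrreducible hS ∈ Sᶜ := h _ hc.isOpen_compl hψ
      rw [hU] at hmem
      obtain ⟨φ, hφ, hφU⟩ := hmem
      rw [← hU] at hφU
      exact hφU hφ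
    · rintro hψ _ ⟨U, rfl⟩ hU
      exact ⟨ψ, hψ, hU⟩

theorem PtSpace.exists_forall_mem_iff [QuasiSober X] (φ : PtSpace X) :
    ∃ x : X, ∀ U : Opens X, x ∈ U ↔ φ U := by
  set W : Opens X := sSup {U | ¬ φ U} with hW
  have hφW : ¬ φ W := by
    rw [hW, map_sSup, sSup_Prop_eq]
    rintro ⟨_, ⟨U, hU, rfl⟩, h⟩
    exact hU h
  have key (U : Opens X) : φ U ↔ ((W : Set X)ᶜ ∩ U).Nonempty := by
    constructor
    · intro h
      by_contra hne
      refine hφW (OrderHomClass.mono φ (fun x hx => ?_ : U ≤ W) h)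
      by_contra hxW
      exact hne ⟨x, hxW, hx⟩
    · rintro ⟨x, hxW, hxU⟩
      by_contra h
      exact hxW ((le_sSup h : U ≤ W) hxU)
  have hirr : IsIrreducible (W : Set X)ᶜ := by
    constructor
    · have h : φ ⊤ := by rw [map_top]; trivial
      exact ((key ⊤).1 h).mono Set.inter_subset_left
    · intro u v hu hv hnu hnv
      have h : φ (⟨u, hu⟩ ⊓ ⟨v, hv⟩) := by
        rw [map_inf]
        exact ⟨(key ⟨u, hu⟩).2 hnu, (key ⟨v, hv⟩).2 hnv⟩
      exact (key _).1 h
  obtain ⟨x, hx⟩ := QuasiSober.sober hirr W.isOpen.isClosed_compl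
  exact ⟨x, fun U => (hx.mem_open_set_iff U.isOpen).trans (key U).symm⟩

/-- Sober spaces are reflective in `Top`: for every topological space `X`, the space `pt X`
is sober, the map `η_X : X → pt X` is continuous, and every continuous map `f : X → Y` into
a sober space `Y` factors uniquely through `η_X` via a continuous map. -/
theorem sober_reflective (X : Type*) [TopologicalSpace X] :
    (T0Space (PtSpace X) ∧ QuasiSober (PtSpace X)) ∧
    Continuous (eta X) ∧
    ∀ (Y : Type*) [TopologicalSpace Y] [T0Space Y] [QuasiSober Y] (f : X → Y),
      Continuous f → ∃! g : PtSpace X → Y, Continuous g ∧ g ∘ eta X = f := by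
  refine ⟨⟨PtSpace.t0Space, PtSpace.quasiSober⟩, eta_continuous, ?_⟩
  intro Y _ _ _ f hf
  choose g hg using fun φ : PtSpace X =>
    PtSpace.exists_forall_mem_iff (φ.comp (Opens.comap ⟨f, hf⟩))
  refine ⟨g, ⟨continuous_def.2 fun V hV => ?_, funext fun x => ?_⟩, ?_⟩
  · exact ⟨Opens.comap ⟨f, hf⟩ ⟨V, hV⟩, Set.ext fun φ => hg φ ⟨V, hV⟩⟩
  · exact (inseparable_iff_forall_isOpen.2 fun V hV => hg (eta X x) ⟨V, hV⟩).eq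
  · rintro g' ⟨hc, hf'⟩
    refine funext fun φ => (inseparable_iff_forall_isOpen.2 fun V hV => ?_).eq
    obtain ⟨U, hU⟩ := hV.preimage hc
    have hUV : U = Opens.comap ⟨f, hf⟩ ⟨V, hV⟩ := by
      ext x
      change eta X x ∈ {φ : PtSpace X | φ U} ↔ f x ∈ V
      rw [← hU, ← hf']
      rfl
    refine Iff.trans ?_ (hg φ ⟨V, hV⟩).symm
    change φ ∈ g' ⁻¹' V ↔ φ (Opens.comap ⟨f, hf⟩ ⟨V, hV⟩)
    rw [hU, hUV]
    rfl
end

section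
/- For every topological space X and every subset M ⊆ X, the b-closure operator is idempotent: [[M]] = [M]. -/
/-- The b-closure of a subset `M` of a topological space: the set of points `y` such that
any two open sets agreeing on `M` cannot separate `y`. -/
def bClosure {Y : Type*} [TopologicalSpace Y] (M : Set Y) : Set Y :=
  {y : Y | ∀ U V : Set Y, IsOpen U → IsOpen V → U ∩ M = V ∩ M → (y ∈ U ↔ y ∈ V)}

/-- The b-closure operator is idempotent: `[[M]] = [M]`. -/
theorem bClosure_idempotent {X : Type*} [TopologicalSpace X] (M : Set X) :
    bClosure (bClosure M) = bClosure M := by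
  refine Set.Subset.antisymm (fun y hy U V hU hV h ↦ hy U V hU hV ?_)
    (fun y hy U V _ _ h ↦ ?_)
  · ext z
    exact and_congr_left fun hz ↦ hz U V hU hV h
  · simpa [hy] using Set.ext_iff.mp h y
end

section
/- Firmness of the sober epireflection: let X be a T0 topological space, Y a sober topological space, and f : X → Y a topological embedding which is an epimorphism in the category of T0 topological spaces. Then the unique continuous map f* : pt X → Y satisfying f* ∘ η_X = f is a homeomorphism. -/
open TopologicalSpace Topology

variable {X : Type*} [TopologicalSpace X]

/-- In a quasi-sober space every point of the frame of opens comes from a point of the space. -/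
theorem exists_etaHom_eq {Y : Type*} [TopologicalSpace Y] [QuasiSober Y] (φ : PtSpace Y) :
    ∃ y : Y, etaHom y = φ := by
  set W : Opens Y := sSup {U | ¬ φ U} with hW
  have hφW : ¬ φ W := by
    rw [hW, map_sSup, sSup_Prop_eq]
    rintro ⟨p, ⟨U, hU, rfl⟩, hp⟩
    exact hU hp
  have le_iff (U : Opens Y) : U ≤ W ↔ ¬ φ U :=
    ⟨fun h hU => hφW (OrderHomClass.mono φ h hU), fun h => le_sSup h⟩
  have meets_iff (U : Opens Y) : ((W : Set Y)ᶜ ∩ U).Nonempty ↔ φ U := by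
    rw [← not_iff_not, ← le_iff, Set.not_nonempty_iff_eq_empty, Set.inter_comm,
      ← Set.sdiff_eq, Set.sdiff_eq_empty, SetLike.coe_subset_coe]
  have hirr : IsIrreducible ((W : Set Y)ᶜ) := by
    refine ⟨?_, fun U V hU hV hWU hWV => ?_⟩
    · have h := (meets_iff ⊤).2 (by simp)
      exact h.left
    · have h : φ (⟨U, hU⟩ ⊓ ⟨V, hV⟩) := by
        rw [map_inf]
        exact ⟨(meets_iff ⟨U, hU⟩).1 hWU, (meets_iff ⟨V, hV⟩).1 hWV⟩
      exact (meets_iff _).2 h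
  obtain ⟨y, hy⟩ := QuasiSober.sober hirr W.isOpen.isClosed_compl
  refine ⟨y, DFunLike.ext _ _ fun U => propext ?_⟩
  exact (hy.mem_open_set_iff U.isOpen).trans (meets_iff U)

/-- A map out of `pt X` is a continuous extension of `f` along `η_X` exactly when it pulls back
each open set `V` to the open set of `pt X` determined by `f ⁻¹ V`. -/
theorem continuous_and_comp_eta_iff {X Y : Type*} [TopologicalSpace X] [TopologicalSpace Y]
    [T0Space Y] (f : C(X, Y)) (g : PtSpace X → Y) :
    (Continuous g ∧ g ∘ eta X = f) ↔
      ∀ (φ : PtSpace X) (V : Opens Y), g φ ∈ V ↔ φ (Opens.comap f V) := by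
  constructor
  · rintro ⟨hg, hgf⟩ φ V
    obtain ⟨U, hU⟩ : ∃ U : Opens X, g ⁻¹' V = {φ : PtSpace X | φ U} := V.isOpen.preimage hg
    have hUV : U = Opens.comap f V := by
      ext x
      have h : g (eta X x) ∈ V ↔ x ∈ U := Set.ext_iff.1 hU (eta X x)
      rw [← Function.comp_apply (f := g), hgf] at h
      exact h.symm
    rw [← hUV]
    exact Set.ext_iff.1 hU φ
  · intro h
    refine ⟨continuous_def.2 fun V hV => ⟨Opens.comap f ⟨V, hV⟩, ?_⟩, funext fun x => ?_⟩
    · ext φ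
      exact h φ ⟨V, hV⟩
    · refine (inseparable_iff_forall_isOpen.2 fun V hV => ?_).eq
      exact h (eta X x) ⟨V, hV⟩

/-- A continuous map into a sober space extends uniquely along `η_X`. -/
theorem existsUnique_continuous_comp_eta {X Y : Type*} [TopologicalSpace X] [TopologicalSpace Y]
    [T0Space Y] [QuasiSober Y] (f : C(X, Y)) :
    ∃! g : PtSpace X → Y, Continuous g ∧ g ∘ eta X = f := by
  choose p hp using exists_etaHom_eq (Y := Y)
  refine ⟨fun φ => p (φ.comp (Opens.comap f)), (continuous_and_comp_eta_iff f _).2 fun φ V => ?_,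
    fun g hg => funext fun φ => ?_⟩
  · exact iff_of_eq (DFunLike.congr_fun (hp (φ.comp (Opens.comap f))) V)
  · refine (inseparable_iff_forall_isOpen.2 fun V hV => ?_).eq
    exact ((continuous_and_comp_eta_iff f g).1 hg φ ⟨V, hV⟩).trans
      (iff_of_eq (DFunLike.congr_fun (hp (φ.comp (Opens.comap f))) ⟨V, hV⟩)).symm

/-- If `f` induces a bijection on open sets, then every continuous extension of `f` along `η_X`
is a homeomorphism. -/
theorem isHomeomorph_of_comap_bijective {X Y : Type*} [TopologicalSpace X] [TopologicalSpace Y]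
    [T0Space Y] (f : C(X, Y)) (hf : Function.Bijective (Opens.comap f))
    {g : PtSpace X → Y} (hg : Continuous g) (hgf : g ∘ eta X = f) : IsHomeomorph g := by
  have key := (continuous_and_comp_eta_iff f g).1 ⟨hg, hgf⟩
  have hinj : Function.Injective g := fun φ ψ h => DFunLike.ext _ _ fun U => by
    obtain ⟨V, rfl⟩ := hf.2 U
    exact propext (by rw [← key, ← key, h])
  have hsurj : Function.Surjective g := fun y => by
    let e : Opens Y ≃o Opens X :=
      { Equiv.ofBijective _ hf with
        map_rel_iff' := fun {U V} => by
          change Opens.comap f U ≤ Opens.comap f V ↔ U ≤ V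
          rw [← inf_eq_left, ← map_inf, hf.1.eq_iff, inf_eq_left] }
    let φ : PtSpace X := (etaHom y).comp (e.symm : FrameHom (Opens X) (Opens Y))
    refine ⟨φ, (inseparable_iff_forall_isOpen.2 fun V hV => ?_).eq⟩
    refine (key φ ⟨V, hV⟩).trans ?_
    change y ∈ e.symm (e ⟨V, hV⟩) ↔ y ∈ V
    rw [e.symm_apply_apply]
    exact Iff.rfl
  refine ⟨hg, ?_, hinj, hsurj⟩
  rintro _ ⟨U, rfl⟩
  obtain ⟨V, rfl⟩ := hf.2 U
  have hV : {φ : PtSpace X | φ (Opens.comap f V)} = g ⁻¹' V := Set.ext fun φ => (key φ V).symm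
  rw [hV, Set.image_preimage_eq _ hsurj]
  exact V.isOpen

/-- Firmness of the sober epireflection: if `X` is T0, `Y` is sober, and `f : X → Y` is a
topological embedding which is an epimorphism in the category of T0 spaces (i.e. the preimage
map on open sets is injective), then the unique continuous map `f* : pt X → Y` with
`f* ∘ η_X = f` is a homeomorphism. -/
theorem sober_epireflection_firm {X Y : Type*} [TopologicalSpace X] [T0Space X]
    [TopologicalSpace Y] [T0Space Y] [QuasiSober Y] (f : X → Y)
    (hemb : Topology.IsEmbedding f)
    (hepi : Function.Injective (fun U : Opens Y => f ⁻¹' (U : Set Y))) :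
    (∃! g : PtSpace X → Y, Continuous g ∧ g ∘ eta X = f) ∧
    ∀ g : PtSpace X → Y, Continuous g → g ∘ eta X = f → IsHomeomorph g := by
  let F : C(X, Y) := ⟨f, hemb.continuous⟩
  have hF : Function.Bijective (Opens.comap F) := by
    refine ⟨fun U V h => hepi (congrArg (fun W : Opens X => (W : Set X)) h), fun U => ?_⟩
    obtain ⟨V, hV, hVU⟩ := hemb.isInducing.isOpen_iff.1 U.isOpen
    exact ⟨⟨V, hV⟩, Opens.ext hVU⟩
  exact ⟨existsUnique_continuous_comp_eta F,
    fun g hg hgf => isHomeomorph_of_comap_bijective F hF hg hgf⟩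
end

section
/- For every T0 topological space X, the set pt X of frame homomorphisms from Opens X to Prop, regarded as a subset of the product space (Opens X) → Prop (the (Opens X)-fold power of the Sierpiński space with the product topology), is b-closed in that product, and the subspace topology it inherits coincides with the topology on pt X whose open sets are the sets {φ | φ U} for U : Opens X. -/
open TopologicalSpace Topology

variable {X : Type*} [TopologicalSpace X]

theorem isOpen_setOf_apply {ι : Type*} (i : ι) : IsOpen {f : ι → Prop | f i} :=
  continuous_Prop.1 (continuous_apply i)

theorem subset_bClosure {Y : Type*} [TopologicalSpace Y] (M : Set Y) : M ⊆ bClosure M := by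
  intro y hy U V _ _ h
  have := Set.ext_iff.1 h y
  simpa [hy] using this

theorem mem_iff_mem_of_mem_bClosure {Y : Type*} [TopologicalSpace Y] {M : Set Y} {y : Y}
    (hy : y ∈ bClosure M) {U V : Set Y} (hU : IsOpen U) (hV : IsOpen V)
    (h : ∀ z ∈ M, z ∈ U ↔ z ∈ V) : y ∈ U ↔ y ∈ V :=
  hy U V hU hV (Set.ext fun z => and_congr_left (h z))

theorem bClosure_range_frameHom_subset (L : Type*) [CompleteLattice L] :
    bClosure {f : L → Prop | ∃ φ : FrameHom L Prop, ⇑φ = f} ⊆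
      {f : L → Prop | ∃ φ : FrameHom L Prop, ⇑φ = f} := by
  intro f hf
  refine ⟨⟨⟨⟨f, fun a b => ?_⟩, ?_⟩, fun S => ?_⟩, rfl⟩
  · refine propext (mem_iff_mem_of_mem_bClosure hf (isOpen_setOf_apply (a ⊓ b))
      ((isOpen_setOf_apply a).inter (isOpen_setOf_apply b)) ?_)
    rintro _ ⟨φ, rfl⟩
    simp
  · refine propext ((mem_iff_mem_of_mem_bClosure hf (isOpen_setOf_apply ⊤) isOpen_univ ?_).trans
      Iff.rfl)
    rintro _ ⟨φ, rfl⟩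
    simp
  · have key := mem_iff_mem_of_mem_bClosure hf (isOpen_setOf_apply (sSup S))
      (isOpen_biUnion fun a (_ : a ∈ S) => isOpen_setOf_apply a) (by
        rintro _ ⟨φ, rfl⟩
        simp [Prop.exists_iff])
    simpa [Prop.exists_iff] using key

theorem isInducing_coe_ptSpace (X : Type*) [TopologicalSpace X] :
    IsInducing (fun φ : PtSpace X => (⇑φ : Opens X → Prop)) := by
  refine ⟨le_antisymm ?_ ?_⟩
  · rw [← continuous_iff_le_induced]
    exact continuous_pi fun U => continuous_Prop.2 ⟨U, rfl⟩
  · rintro _ ⟨U, rfl⟩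
    exact ⟨{f | f U}, isOpen_setOf_apply U, rfl⟩

/-- For a T0 space `X`, the set `pt X` of frame homomorphisms `Opens X → Prop`, regarded as a
subset of the product space `Opens X → Prop` (the `Opens X`-fold power of the Sierpiński
space), is b-closed in that product, and the subspace topology it inherits coincides with the
topology on `pt X` whose open sets are the sets `{φ | φ U}` (i.e. the coercion
`pt X → (Opens X → Prop)` is inducing). -/
theorem ptSpace_bClosed_and_inducing (X : Type*) [TopologicalSpace X] [T0Space X] :
    bClosure {f : Opens X → Prop | ∃ φ : PtSpace X, ⇑φ = f}
      = {f : Opens X → Prop | ∃ φ : PtSpace X, ⇑φ = f} ∧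
    Topology.IsInducing (fun φ : PtSpace X => (⇑φ : Opens X → Prop)) := by
  exact ⟨(bClosure_range_frameHom_subset (Opens X)).antisymm (subset_bClosure _),
    isInducing_coe_ptSpace X⟩
end

section
/- Sober spaces are closed under b-closed subspaces: if Y is a sober topological space and M ⊆ Y is b-closed (i.e., [M] = M), then M with the subspace topology is sober (T0 and quasi-sober). -/
theorem IsGenericPoint.mem_bClosure {Y : Type*} [TopologicalSpace Y] {y : Y} {T M : Set Y}
    (hy : IsGenericPoint y (closure T)) (hTM : T ⊆ M) : y ∈ bClosure M := by
  have key : ∀ U : Set Y, IsOpen U → (y ∈ U ↔ (T ∩ (U ∩ M)).Nonempty) := fun U hU => by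
    rw [hy.mem_open_set_iff hU, closure_inter_open_nonempty_iff hU, Set.inter_comm U M,
      ← Set.inter_assoc, Set.inter_eq_left.mpr hTM]
  intro U V hU hV hUV
  rw [key U hU, key V hV, hUV]

/-- Sober spaces are closed under b-closed subspaces: if `Y` is sober and `M ⊆ Y` is b-closed
(`[M] = M`), then `M` with the subspace topology is sober (T0 and quasi-sober). -/
theorem sober_of_bClosed_subspace {Y : Type*} [TopologicalSpace Y] [T0Space Y] [QuasiSober Y]
    (M : Set Y) (hM : bClosure M = M) :
    T0Space M ∧ QuasiSober M := by
  refine ⟨inferInstance, ⟨fun {S} hS hSc => ?_⟩⟩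
  have hirr : IsIrreducible (Subtype.val '' S) := hS.image _ continuous_subtype_val.continuousOn
  obtain ⟨y, hy⟩ := QuasiSober.sober hirr.closure isClosed_closure
  have hyM : y ∈ M := hM ▸ hy.mem_bClosure (Subtype.coe_image_subset M S)
  refine ⟨⟨y, hyM⟩, ?_⟩
  rw [IsGenericPoint, Topology.IsEmbedding.subtypeVal.closure_eq_preimage_closure_image,
    Set.image_singleton, hy.def,
    ← Topology.IsEmbedding.subtypeVal.closure_eq_preimage_closure_image, hSc.closure_eq]
end

section
/- Sobriety via an equalizer: let X be a topological space, let TX = (C(X, 𝕊) → Prop) be the C(X, 𝕊)-fold power of the Sierpiński space with the product topology, and let ψ_X : X → TX be given by ψ_X(x)(p) = p(x). Define EX = {f ∈ TX | for every continuous map α : TX → Prop, f(α ∘ ψ_X) = α(f)} with the subspace topology. Then ψ_X(x) ∈ EX for every x ∈ X, and X is sober (T0 and quasi-sober) if and only if the corestriction k_X : X → EX of ψ_X is a homeomorphism. -/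
open Topology

variable (X : Type*) [TopologicalSpace X]

/-- The map `ψ_X : X → TX`, where `TX = (C(X, 𝕊) → Prop)` is the `C(X, 𝕊)`-fold power of the
Sierpiński space, given by `ψ_X(x)(p) = p(x)`; it is continuous. -/
def psiMap : C(X, C(X, Prop) → Prop) :=
  ⟨fun x p => p x, continuous_pi fun p => p.continuous⟩

/-- `EX`: the equalizer of `Tψ_X` and `ψ_{TX}`, i.e. the set of those `f ∈ TX` such that
`f(α ∘ ψ_X) = α(f)` for every continuous `α : TX → Prop`. -/
def EXset : Set (C(X, Prop) → Prop) :=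
  {f : C(X, Prop) → Prop |
    ∀ α : C(C(X, Prop) → Prop, Prop), f (α.comp (psiMap X)) = α f}

variable {X}

/-- Every point of an open subset of a power of the Sierpiński space has a basic neighbourhood
given by finitely many coordinates being true. -/
theorem exists_finset_forall_imp_of_continuous {ι : Type*} (α : C(ι → Prop, Prop))
    {f : ι → Prop} (hf : α f) :
    ∃ I : Finset ι, (∀ i ∈ I, f i) ∧ ∀ g : ι → Prop, (∀ i ∈ I, g i) → α g := by
  classical
  obtain ⟨I, u, hu, hsub⟩ := isOpen_pi_iff.1 (continuous_Prop.1 α.continuous) f hf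
  refine ⟨I.filter f, fun i hi => (Finset.mem_filter.1 hi).2, fun g hg => hsub fun i hi => ?_⟩
  exact IsUpper.isUpperSet_of_isOpen (hu i hi).1
    (fun hfi => hg i (Finset.mem_filter.2 ⟨hi, hfi⟩)) (hu i hi).2

theorem psiMap_mem_EXset (x : X) : psiMap X x ∈ EXset X := fun _ => rfl

theorem isInducing_psiMap : IsInducing (psiMap X) := by
  rw [isInducing_iff]
  refine le_antisymm (psiMap X).continuous.le_induced fun U hU => ?_
  refine ⟨{f | f ⟨(· ∈ U), continuous_Prop.2 hU⟩}, ?_, rfl⟩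
  exact continuous_Prop.1 (continuous_apply _)

theorem EXset_inf {f : C(X, Prop) → Prop} (hf : f ∈ EXset X) {p q r : C(X, Prop)}
    (hr : ∀ x, r x ↔ p x ∧ q x) : f r ↔ f p ∧ f q := by
  have hα : Continuous fun g : C(X, Prop) → Prop => g p ∧ g q :=
    continuous_Prop.2 ((continuous_Prop.1 (continuous_apply p)).inter
      (continuous_Prop.1 (continuous_apply q)))
  have hcomp : ContinuousMap.comp ⟨_, hα⟩ (psiMap X) = r :=
    ContinuousMap.ext fun x => propext (hr x).symm
  exact hcomp ▸ iff_of_eq (hf ⟨_, hα⟩)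

theorem EXset_sup {f : C(X, Prop) → Prop} (hf : f ∈ EXset X) (S : Set C(X, Prop))
    {r : C(X, Prop)} (hr : ∀ x, r x ↔ ∃ p ∈ S, p x) : f r ↔ ∃ p ∈ S, f p := by
  have hα : Continuous fun g : C(X, Prop) → Prop => ∃ p ∈ S, g p := by
    rw [continuous_Prop]
    have : {g : C(X, Prop) → Prop | ∃ p ∈ S, g p} = ⋃ p ∈ S, {g | g p} := by ext; simp
    rw [this]
    exact isOpen_biUnion fun p _ => continuous_Prop.1 (continuous_apply p)
  have hcomp : ContinuousMap.comp ⟨_, hα⟩ (psiMap X) = r :=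
    ContinuousMap.ext fun x => propext (hr x).symm
  exact hcomp ▸ iff_of_eq (hf ⟨_, hα⟩)

theorem EXset_mono {f : C(X, Prop) → Prop} (hf : f ∈ EXset X) {p q : C(X, Prop)}
    (hpq : ∀ x, p x → q x) (hp : f p) : f q :=
  ((EXset_inf hf fun x => ⟨fun h => ⟨h, hpq x h⟩, And.left⟩).1 hp).2

theorem EXset_true {f : C(X, Prop) → Prop} (hf : f ∈ EXset X) {r : C(X, Prop)}
    (hr : ∀ x, r x) : f r := by
  have hcomp : (ContinuousMap.const _ True).comp (psiMap X) = r :=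
    ContinuousMap.ext fun x => propext ⟨fun _ => hr x, fun _ => trivial⟩
  exact hcomp ▸ of_eq_true (hf (ContinuousMap.const _ True))

theorem exists_psiMap_eq_of_mem_EXset [QuasiSober X] {f : C(X, Prop) → Prop}
    (hf : f ∈ EXset X) : ∃ x, psiMap X x = f := by
  have hr : Continuous fun x : X => ∃ p ∈ {p : C(X, Prop) | ¬ f p}, p x := by
    rw [continuous_Prop]
    have : {x : X | ∃ p ∈ {p : C(X, Prop) | ¬ f p}, p x} =
        ⋃ p ∈ {p : C(X, Prop) | ¬ f p}, {x | p x} := by ext; simp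
    rw [this]
    exact isOpen_biUnion fun p _ => continuous_Prop.1 p.continuous
  let r : C(X, Prop) := ⟨_, hr⟩
  have hfr : ¬ f r := fun h =>
    let ⟨_, hp, hfp⟩ := (EXset_sup hf {p | ¬ f p} fun _ => Iff.rfl).1 h
    hp hfp
  have key (p : C(X, Prop)) : f p ↔ ({x | r x}ᶜ ∩ {x | p x}).Nonempty := by
    refine ⟨fun hp => ?_, fun ⟨x, hx, hpx⟩ => by_contra fun hp => hx ⟨p, hp, hpx⟩⟩
    by_contra h
    refine hfr (EXset_mono hf (fun x hpx => ?_) hp)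
    by_contra hx
    exact h ⟨x, hx, hpx⟩
  have hclosed : IsClosed {x | r x}ᶜ := (continuous_Prop.1 hr).isClosed_compl
  have hirr : IsIrreducible {x | r x}ᶜ := by
    refine ⟨((key (ContinuousMap.const X True)).1 (EXset_true hf fun _ => trivial)).mono
      Set.inter_subset_left, fun U V hU hV hSU hSV => ?_⟩
    have hU' := (key ⟨(· ∈ U), continuous_Prop.2 hU⟩).2 hSU
    have hV' := (key ⟨(· ∈ V), continuous_Prop.2 hV⟩).2 hSV
    exact (key ⟨(· ∈ U ∩ V), continuous_Prop.2 (hU.inter hV)⟩).1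
      ((EXset_inf hf fun _ => Iff.rfl).2 ⟨hU', hV'⟩)
  obtain ⟨x, hx⟩ := QuasiSober.sober hirr hclosed
  refine ⟨x, funext fun p => propext ?_⟩
  exact (hx.mem_open_set_iff (continuous_Prop.1 p.continuous)).trans (key p).symm

/-- The opens meeting a fixed irreducible set define a point of `EX`. -/
theorem IsIrreducible.inter_nonempty_mem_EXset {S : Set X} (hS : IsIrreducible S) :
    (fun p : C(X, Prop) => (S ∩ {x | p x}).Nonempty) ∈ EXset X := by
  classical
  refine fun α => propext ⟨fun ⟨x, hxS, hx⟩ => ?_, fun h => ?_⟩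
  · obtain ⟨I, hI, hα⟩ := exists_finset_forall_imp_of_continuous α hx
    exact hα _ fun p hp => ⟨x, hxS, hI p hp⟩
  · obtain ⟨I, hI, hα⟩ := exists_finset_forall_imp_of_continuous α h
    obtain ⟨x, hxS, hx⟩ := isIrreducible_iff_sInter.1 hS (I.image fun p => {x | p x})
      (by simpa using fun p _ => continuous_Prop.1 p.continuous) (by simpa using hI)
    exact ⟨x, hxS, hα _ fun p hp => hx _ (Finset.mem_coe.2 (Finset.mem_image_of_mem _ hp))⟩

theorem quasiSober_of_forall_mem_EXset (h : ∀ f ∈ EXset X, ∃ x, psiMap X x = f) :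
    QuasiSober X := by
  refine ⟨fun {S} hS hclosed => ?_⟩
  obtain ⟨x, hx⟩ := h _ hS.inter_nonempty_mem_EXset
  have key {U : Set X} (hU : IsOpen U) : x ∈ U ↔ (S ∩ U).Nonempty :=
    iff_of_eq (congrFun hx ⟨(· ∈ U), continuous_Prop.2 hU⟩)
  have hxS : x ∈ S := by
    by_contra hxS
    obtain ⟨y, hyS, hy⟩ := (key hclosed.isOpen_compl).1 hxS
    exact hy hyS
  refine ⟨x, (hclosed.closure_subset_iff.2 (Set.singleton_subset_iff.2 hxS)).antisymm
    fun y hy => ?_⟩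
  exact (specializes_iff_forall_open.2 fun U hU hyU => (key hU).2 ⟨y, hy, hyU⟩).mem_closure

variable (X)

/-- `ψ_X` takes values in `EX`, and `X` is sober (T0 and quasi-sober) if and only if the
corestriction `k_X : X → EX` of `ψ_X` is a homeomorphism (where `EX` carries the subspace
topology). -/
theorem sober_iff_corestriction_psi_isHomeomorph :
    (∀ x : X, psiMap X x ∈ EXset X) ∧
    ∀ h : ∀ x : X, psiMap X x ∈ EXset X,
      ((T0Space X ∧ QuasiSober X) ↔
        IsHomeomorph (Set.codRestrict (psiMap X) (EXset X) h)) := by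
  refine ⟨psiMap_mem_EXset, fun h => ⟨fun ⟨_, _⟩ => ?_, fun hk => ⟨?_, ?_⟩⟩⟩
  · have hind := isInducing_psiMap.codRestrict h
    refine isHomeomorph_iff_isEmbedding_surjective.2 ⟨⟨hind, hind.injective⟩, fun f => ?_⟩
    obtain ⟨x, hx⟩ := exists_psiMap_eq_of_mem_EXset f.2
    exact ⟨x, Subtype.ext hx⟩
  · exact hk.isEmbedding.t0Space
  · refine quasiSober_of_forall_mem_EXset fun f hf => ?_
    obtain ⟨x, hx⟩ := hk.surjective ⟨f, hf⟩
    exact ⟨x, congrArg Subtype.val hx⟩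
end
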